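/- arXiv:2012.14931 — 14 statements merged into one kernel-verified Lean document; each statement's English description precedes it below -/
import Mathlib

section
/- Let S be a finite block-group, s ∈ S, and e an idempotent with e ≤_R s. Then e = (es)(es)⁻¹ = s(es)⁻¹ = s(es)⁻¹e, the element (es)⁻¹(es) is an idempotent with (es)⁻¹(es) ≤_L s, and (es)⁻¹(es) is 𝒟-related to e (i.e., there exists c ∈ S with e ℛ c and c ℒ (es)⁻¹(es)). -/
/-- A (finite) semigroup is a block-group iff every element has at most one inverse. -/
def IsBlockGroup (S : Type*) [Semigroup S] : Prop :=
  ∀ a b c : S, a * b * a = a → b * a * b = b → a * c * a = a → c * a * c = c → b = c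

/-- `a ≤_R b` : `a ∈ b S¹`. -/
def leR {S : Type*} [Semigroup S] (a b : S) : Prop := a = b ∨ ∃ x, a = b * x

/-- `a ≤_L b` : `a ∈ S¹ b`. -/
def leL {S : Type*} [Semigroup S] (a b : S) : Prop := a = b ∨ ∃ x, a = x * b

/-- Green's relation ℛ : `a S¹ = b S¹`. -/
def RRel {S : Type*} [Semigroup S] (a b : S) : Prop := leR a b ∧ leR b a

/-- Green's relation ℒ : `S¹ a = S¹ b`. -/
def LRel {S : Type*} [Semigroup S] (a b : S) : Prop := leL a b ∧ leL b a

/-- An element is regular if `a y a = a` for some `y`. -/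
def IsRegularElem {S : Type*} [Semigroup S] (a : S) : Prop := ∃ y, a * y * a = a

/-- `x ∈ 𝒟(s)` : `x = x e` for some idempotent `e ≤_R s`. -/
def inD {S : Type*} [Semigroup S] (s x : S) : Prop :=
  ∃ e, e * e = e ∧ leR e s ∧ x = x * e

/-- `x ∈ ℐ(s)` : `x = x e` for some idempotent `e ≤_L s`. -/
def inI {S : Type*} [Semigroup S] (s x : S) : Prop :=
  ∃ e, e * e = e ∧ leL e s ∧ x = x * e

/-- `spow a n = a ^ (n+1)` : positive powers in a semigroup. -/
def spow {S : Type*} [Semigroup S] (a : S) : ℕ → S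
  | 0 => a
  | n + 1 => spow a n * a

theorem stmt_2 {S : Type*} [Semigroup S] [Fintype S] (hS : IsBlockGroup S)
    (s e i : S) (he : e * e = e) (hR : leR e s)
    (hi1 : (e * s) * i * (e * s) = e * s) (hi2 : i * (e * s) * i = i) :
    e = (e * s) * i ∧ e = s * i ∧ e = s * i * e ∧
    (i * (e * s)) * (i * (e * s)) = i * (e * s) ∧
    leL (i * (e * s)) s ∧
    ∃ c, RRel e c ∧ LRel c (i * (e * s)) := by
  obtain ⟨x, hx⟩ : ∃ x, s * x = e := by
    rcases hR with rfl | ⟨x, hx⟩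
    · exact ⟨e, he⟩
    · exact ⟨x, hx.symm⟩
  have hesx : e * s * (x * e) = e := by
    rw [← mul_assoc, mul_assoc e s x, hx, he, he]
  have hi : x * e = i := by
    refine hS (e * s) (x * e) i ?_ ?_ hi1 hi2
    · rw [hesx, ← mul_assoc, he]
    · rw [mul_assoc, hesx, mul_assoc, he]
  have hesi : e = e * s * i := by rw [← hi, hesx]
  have hsi : e = s * i := by rw [← hi, ← mul_assoc, hx, he]
  refine ⟨hesi, hsi, by rw [← hsi, he], ?_, Or.inr ⟨i * e, (mul_assoc i e s).symm⟩, e * s,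
    ⟨Or.inr ⟨i, hesi⟩, Or.inr ⟨s, rfl⟩⟩, Or.inr ⟨e * s, ?_⟩, Or.inr ⟨i, rfl⟩⟩
  · rw [← mul_assoc, hi2]
  · rw [← mul_assoc, hi1]
end

section
/- Let S be a finite block-group, s ∈ S, and e an idempotent with e ≤_L s. Then e = (se)⁻¹(se) = (se)⁻¹s = e(se)⁻¹s, the element (se)(se)⁻¹ is an idempotent with (se)(se)⁻¹ ≤_R s, and (se)(se)⁻¹ is 𝒟-related to e (i.e., there exists c ∈ S with e ℛ c and c ℒ (se)(se)⁻¹). -/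
theorem stmt_3 {S : Type*} [Semigroup S] [Fintype S] (hS : IsBlockGroup S)
    (s e i : S) (he : e * e = e) (hL : leL e s)
    (hi1 : (s * e) * i * (s * e) = s * e) (hi2 : i * (s * e) * i = i) :
    e = i * (s * e) ∧ e = i * s ∧ e = e * (i * s) ∧
    ((s * e) * i) * ((s * e) * i) = (s * e) * i ∧
    leR ((s * e) * i) s ∧
    ∃ c, RRel e c ∧ LRel c ((s * e) * i) := by
  obtain ⟨x, hx⟩ : ∃ x, e = x * s := by
    rcases hL with rfl | h
    · exact ⟨e, he.symm⟩
    · exact h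
  have hxm : e * x * (s * e) = e := by
    rw [mul_assoc, ← mul_assoc x, ← hx, he, he]
  have hie : i = e * x := by
    refine hS (s * e) i (e * x) hi1 hi2 ?_ ?_
    · rw [mul_assoc, hxm, mul_assoc, he]
    · rw [hxm, ← mul_assoc, he]
  have him : i * (s * e) = e := by rw [hie, hxm]
  have his : i * s = e := by rw [hie, mul_assoc, ← hx, he]
  refine ⟨him.symm, his.symm, by rw [his, he], by rw [← mul_assoc, hi1],
    Or.inr ⟨e * i, mul_assoc _ _ _⟩, i, ⟨Or.inr ⟨s * e, him.symm⟩, Or.inr ⟨i, ?_⟩⟩,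
    Or.inr ⟨i, ?_⟩, Or.inr ⟨s * e, rfl⟩⟩
  · rw [← him, hi2]
  · rw [← mul_assoc, hi2]
end

section
/- Let S be a finite block-group and let e, f be idempotents of S. Then e = ef if and only if e = fe (and hence each condition is equivalent to e ≤ f, where e ≤ f means e = ef = fe). -/
/-- In a block-group, an idempotent `e` with `e = e * f` satisfies `e = f * e`. -/
theorem IsBlockGroup.eq_mul_left_of_eq_mul_right {S : Type*} [Semigroup S]
    (hS : IsBlockGroup S) {e f : S} (he : e * e = e) (h : e = e * f) : e = f * e := by
  have hefe : e * (f * e) = e := by rw [← mul_assoc, ← h, he]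
  refine hS e e (f * e) (by rw [he, he]) (by rw [he, he]) (by rw [hefe, he]) ?_
  rw [mul_assoc f e e, he, mul_assoc f e (f * e), hefe]

/-- In a block-group, an idempotent `e` with `e = f * e` satisfies `e = e * f`. -/
theorem IsBlockGroup.eq_mul_right_of_eq_mul_left {S : Type*} [Semigroup S]
    (hS : IsBlockGroup S) {e f : S} (he : e * e = e) (h : e = f * e) : e = e * f := by
  have hefe : e * f * e = e := by rw [mul_assoc, ← h, he]
  refine hS e e (e * f) (by rw [he, he]) (by rw [he, he]) ?_ ?_
  · rw [← mul_assoc, he, hefe]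
  · rw [hefe, ← mul_assoc, he]

theorem stmt_4 {S : Type*} [Semigroup S] [Fintype S] (hS : IsBlockGroup S)
    (e f : S) (he : e * e = e) (hf : f * f = f) :
    (e = e * f ↔ e = f * e) ∧
    (e = e * f ↔ (e = e * f ∧ e = f * e)) ∧
    (e = f * e ↔ (e = e * f ∧ e = f * e)) := by
  have right_to_left := hS.eq_mul_left_of_eq_mul_right (f := f) he
  have left_to_right := hS.eq_mul_right_of_eq_mul_left (f := f) he
  exact ⟨⟨right_to_left, left_to_right⟩, ⟨fun h => ⟨h, right_to_left h⟩, And.left⟩,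
    ⟨fun h => ⟨left_to_right h, h⟩, And.right⟩⟩
end

section
/- Let S be a finite block-group and let e, f be idempotents of S. Let g be the unique idempotent power of ef (i.e. g = (ef)^n for some n ≥ 1 with g idempotent). Then g is the greatest lower bound of e and f in the natural partial order on E(S): g ≤ e, g ≤ f, and every idempotent h with h ≤ e and h ≤ f satisfies h ≤ g. Consequently, the idempotents of S under the natural partial order form a meet-semilattice with e ∧ f = (ef)^ω. -/
theorem mul_spow_eq_of_mul_eq {S : Type*} [Semigroup S] {a x : S} (h : x * a = x) (n : ℕ) :
    x * spow a n = x := by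
  induction n with
  | zero => exact h
  | succ n ih => rw [spow, ← mul_assoc, ih, h]

theorem spow_mul_eq_of_mul_eq {S : Type*} [Semigroup S] {a x : S} (h : a * x = x) (n : ℕ) :
    spow a n * x = x := by
  induction n with
  | zero => exact h
  | succ n ih => rw [spow, mul_assoc, h, ih]

theorem mul_spow_eq_spow_of_mul_eq {S : Type*} [Semigroup S] {a x : S} (h : x * a = a) (n : ℕ) :
    x * spow a n = spow a n := by
  induction n with
  | zero => exact h
  | succ n ih => rw [spow, ← mul_assoc, ih]

theorem spow_mul_eq_spow_of_mul_eq {S : Type*} [Semigroup S] {a x : S} (h : a * x = a) (n : ℕ) :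
    spow a n * x = spow a n := by
  cases n with
  | zero => exact h
  | succ n => rw [spow, mul_assoc, h]

/-- In a block-group, mutually inverse elements one of which is idempotent are equal. -/
theorem IsBlockGroup.eq_of_idempotent_of_inverse {S : Type*} [Semigroup S] (hS : IsBlockGroup S)
    {x y : S} (hx : x * x = x) (hxy : x * y * x = x) (hyx : y * x * y = y) : x = y :=
  hS x x y (by rw [hx, hx]) (by rw [hx, hx]) hxy hyx

theorem stmt_5 {S : Type*} [Semigroup S] [Fintype S] (hS : IsBlockGroup S)
    (e f : S) (he : e * e = e) (hf : f * f = f) :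
    ∀ g : S, (∃ n : ℕ, g = spow (e * f) n) → g * g = g →
      (g = g * e ∧ g = e * g) ∧ (g = g * f ∧ g = f * g) ∧
      ∀ h : S, h * h = h → (h = h * e ∧ h = e * h) → (h = h * f ∧ h = f * h) →
        (h = h * g ∧ h = g * h) := by
  rintro g ⟨n, hn⟩ hg
  have heg : e * g = g := by
    rw [hn]
    exact mul_spow_eq_spow_of_mul_eq (by rw [← mul_assoc, he]) n
  have hgf : g * f = g := by
    rw [hn]
    exact spow_mul_eq_spow_of_mul_eq (by rw [mul_assoc, hf]) n
  have hge : g = g * e := by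
    apply hS.eq_of_idempotent_of_inverse hg
    · rw [← mul_assoc, hg, mul_assoc, heg, hg]
    · rw [mul_assoc g e g, heg, hg, ← mul_assoc, hg]
  have hfg : g = f * g := by
    apply hS.eq_of_idempotent_of_inverse hg
    · rw [← mul_assoc, hgf, hg, hg]
    · rw [mul_assoc f g g, hg, mul_assoc, ← mul_assoc g f g, hgf, hg]
  refine ⟨⟨hge, heg.symm⟩, ⟨hgf.symm, hfg⟩, ?_⟩
  rintro h - ⟨hhe, heh⟩ ⟨hhf, hfh⟩
  rw [hn]
  exact ⟨(mul_spow_eq_of_mul_eq (by rw [← mul_assoc, ← hhe, ← hhf]) n).symm,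
    (spow_mul_eq_of_mul_eq (by rw [mul_assoc, ← hfh, ← heh]) n).symm⟩
end

section
/- Let S be a finite block-group and let e, f be idempotents of S. Then the unique idempotent power of ef equals the unique idempotent power of fe, i.e. (ef)^ω = (fe)^ω. -/
theorem mul_spow_of_mul_eq_self {S : Type*} [Semigroup S] {a b : S} (h : a * b = a) (n : ℕ) :
    a * spow b n = a := by
  induction n with
  | zero => exact h
  | succ n ih => rw [spow, ← mul_assoc, ih, h]

theorem spow_mul_of_mul_eq_self {S : Type*} [Semigroup S] {a b : S} (h : b * a = a) (n : ℕ) :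
    spow b n * a = a := by
  induction n with
  | zero => exact h
  | succ n ih => rw [spow, mul_assoc, h, ih]

theorem mul_spow_of_mul_eq_right {S : Type*} [Semigroup S] {a b : S} (h : a * b = b) (n : ℕ) :
    a * spow b n = spow b n := by
  induction n with
  | zero => exact h
  | succ n ih => rw [spow, ← mul_assoc, ih]

theorem spow_mul_of_mul_eq_left {S : Type*} [Semigroup S] {a b : S} (h : b * a = b) (n : ℕ) :
    spow b n * a = spow b n := by
  cases n with
  | zero => exact h
  | succ n => rw [spow, mul_assoc, h]

/-- In a block-group, `ℒ`-equivalent idempotents are equal. -/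
theorem IsBlockGroup.eq_of_mul_eq_left {S : Type*} [Semigroup S] (hS : IsBlockGroup S) {g k : S}
    (hg : g * g = g) (hk : k * k = k) (hgk : g * k = g) (hkg : k * g = k) : g = k :=
  hS g g k (by rw [hg, hg]) (by rw [hg, hg]) (by rw [hgk, hg]) (by rw [hkg, hk])

/-- In a block-group, `ℛ`-equivalent idempotents are equal. -/
theorem IsBlockGroup.eq_of_mul_eq_right {S : Type*} [Semigroup S] (hS : IsBlockGroup S) {g k : S}
    (hg : g * g = g) (hgk : g * k = k) (hkg : k * g = g) : g = k :=
  hS g g k (by rw [hg, hg]) (by rw [hg, hg]) (by rw [hgk, hkg]) (by rw [hkg, hgk])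

/-- In a block-group, an idempotent power of a product `e * f` of idempotents is fixed by
multiplication by `e` and by `f` on either side. -/
theorem IsBlockGroup.idempotent_spow_mul {S : Type*} [Semigroup S] (hS : IsBlockGroup S)
    {e f : S} (he : e * e = e) (hf : f * f = f) {n : ℕ}
    (hg : spow (e * f) n * spow (e * f) n = spow (e * f) n) :
    e * spow (e * f) n = spow (e * f) n ∧ f * spow (e * f) n = spow (e * f) n ∧
      spow (e * f) n * e = spow (e * f) n ∧ spow (e * f) n * f = spow (e * f) n := by
  have heg : e * spow (e * f) n = spow (e * f) n :=
    mul_spow_of_mul_eq_right (by rw [← mul_assoc, he]) n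
  have hgf : spow (e * f) n * f = spow (e * f) n :=
    spow_mul_of_mul_eq_left (by rw [mul_assoc, hf]) n
  generalize spow (e * f) n = g at *
  refine ⟨heg, ?_, ?_, hgf⟩
  · refine (hS.eq_of_mul_eq_left hg ?_ ?_ ?_).symm
    · rw [mul_assoc, ← mul_assoc g, hgf, hg]
    · rw [← mul_assoc, hgf, hg]
    · rw [mul_assoc, hg]
  · refine (hS.eq_of_mul_eq_right hg ?_ ?_).symm
    · rw [← mul_assoc, hg]
    · rw [mul_assoc, heg, hg]

theorem stmt_6 {S : Type*} [Semigroup S] [Fintype S] (hS : IsBlockGroup S)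
    (e f : S) (he : e * e = e) (hf : f * f = f) :
    ∀ g h : S, (∃ n : ℕ, g = spow (e * f) n) → g * g = g →
      (∃ m : ℕ, h = spow (f * e) m) → h * h = h → g = h := by
  rintro _ _ ⟨n, rfl⟩ hg ⟨m, rfl⟩ hh
  obtain ⟨-, -, hge, hgf⟩ := hS.idempotent_spow_mul he hf hg
  obtain ⟨hfh, heh, -, -⟩ := hS.idempotent_spow_mul hf he hh
  calc spow (e * f) n = spow (e * f) n * spow (f * e) m :=
        (mul_spow_of_mul_eq_self (by rw [← mul_assoc, hgf, hge]) m).symm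
    _ = spow (f * e) m := spow_mul_of_mul_eq_self (by rw [mul_assoc, hfh, heh]) n
end

section
/- Let S be a finite semigroup and s, t ∈ S. Then ℐ(s) = ℐ(t) if and only if ℒ(s) = ℒ(t). -/
/-- An idempotent lies in `ℐ(s)` exactly when it lies `ℒ`-below `s`. -/
theorem inI_iff_leL_of_idempotent {S : Type*} [Semigroup S] {s e : S} (he : e * e = e) :
    inI s e ↔ leL e s := by
  refine ⟨?_, fun h => ⟨e, he, h, he.symm⟩⟩
  rintro ⟨f, -, rfl | ⟨x, rfl⟩, h⟩
  · exact Or.inr ⟨e, h⟩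
  · exact Or.inr ⟨e * x, by rwa [mul_assoc]⟩

theorem stmt_8 {S : Type*} [Semigroup S] [Fintype S] (s t : S) :
    (∀ x : S, inI s x ↔ inI t x) ↔
    (∀ e : S, e * e = e → (leL e s ↔ leL e t)) := by
  constructor
  · intro h e he
    rw [← inI_iff_leL_of_idempotent he, ← inI_iff_leL_of_idempotent he, h]
  · intro h x
    exact exists_congr fun e => and_congr_right fun he => and_congr_left' (h e he)
end

section
/- Let S be a finite block-group and s, t ∈ S. Then 𝒟(s) = 𝒟(t) if and only if ℛ(s) = ℛ(t). -/
theorem leR_trans {S : Type*} [Semigroup S] {a b c : S} (hab : leR a b) (hbc : leR b c) :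
    leR a c := by
  rcases hab with rfl | ⟨x, rfl⟩
  · exact hbc
  · rcases hbc with rfl | ⟨y, rfl⟩
    · exact Or.inr ⟨x, rfl⟩
    · exact Or.inr ⟨y * x, mul_assoc _ _ _⟩

/-- In a block-group, the `L`-order on idempotents is contained in the `R`-order. -/
theorem IsBlockGroup.idempotent_eq_mul {S : Type*} [Semigroup S] (hS : IsBlockGroup S) {e f : S}
    (he : e * e = e) (hef : e = e * f) : e = f * e := by
  have h : e * (f * e) = e := by rw [← mul_assoc, ← hef, he]
  refine hS e e (f * e) ?_ ?_ ?_ ?_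
  · rw [he, he]
  · rw [he, he]
  · rw [h, he]
  · rw [mul_assoc f e e, he, mul_assoc, h]

theorem IsBlockGroup.leR_of_inD {S : Type*} [Semigroup S] (hS : IsBlockGroup S) {e t : S}
    (he : e * e = e) (h : inD t e) : leR e t := by
  obtain ⟨f, -, hft, hef⟩ := h
  exact leR_trans (Or.inr ⟨e, hS.idempotent_eq_mul he hef⟩) hft

theorem stmt_9 {S : Type*} [Semigroup S] [Fintype S] (hS : IsBlockGroup S)
    (s t : S) :
    (∀ x : S, inD s x ↔ inD t x) ↔
    (∀ e : S, e * e = e → (leR e s ↔ leR e t)) := by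
  constructor
  · intro h e he
    exact ⟨fun hes => hS.leR_of_inD he ((h e).1 ⟨e, he, hes, he.symm⟩),
      fun het => hS.leR_of_inD he ((h e).2 ⟨e, he, het, he.symm⟩)⟩
  · intro h x
    exact ⟨fun ⟨e, he, hes, hx⟩ => ⟨e, he, (h e he).1 hes, hx⟩,
      fun ⟨e, he, het, hx⟩ => ⟨e, he, (h e he).2 het, hx⟩⟩
end

section
/- Let S be a finite block-group and s ∈ S. If x ∈ 𝒟(s), then xs ∈ ℐ(s). -/
theorem stmt_10 {S : Type*} [Semigroup S] [Fintype S] (hS : IsBlockGroup S)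
    (s x : S) (hx : inD s x) : inI s (x * s) := by
  obtain ⟨e, he, rfl | ⟨t, rfl⟩, hxe⟩ := hx
  · exact ⟨e, he, Or.inl rfl, by rw [mul_assoc, he]⟩
  · refine ⟨t * (s * t) * s, ?_, Or.inr ⟨t * (s * t), rfl⟩, ?_⟩
    · calc t * (s * t) * s * (t * (s * t) * s)
          = t * (s * t * (s * t) * (s * t)) * s := by simp only [mul_assoc]
        _ = t * (s * t) * s := by rw [he, he]
    · calc x * s = x * (s * t * (s * t)) * s := by rw [he, ← hxe]
        _ = x * s * (t * (s * t) * s) := by simp only [mul_assoc]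
end

section
/- Let S be a finite block-group and s ∈ S. The map φ_s : 𝒟(s) → ℐ(s), x ↦ xs, is injective: if x, y ∈ 𝒟(s) and xs = ys, then x = y. -/
/-- A nonempty subset of a finite semigroup closed under multiplication contains an idempotent. -/
theorem exists_idempotent_mem_of_finite {S : Type*} [Semigroup S] [Finite S] (T : Set S)
    (hne : T.Nonempty) (hmul : ∀ a ∈ T, ∀ b ∈ T, a * b ∈ T) : ∃ g ∈ T, g * g = g := by
  let _ : TopologicalSpace S := ⊥
  have : DiscreteTopology S := ⟨rfl⟩
  exact exists_idempotent_in_compact_subsemigroup (fun _ => continuous_of_discreteTopology) T hne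
    T.toFinite.isCompact hmul

/-- In a block-group, `ℛ`-related idempotents are equal. Idempotency of `h` follows from
`hgh` and `hhg`. -/
theorem IsBlockGroup.eq_of_mul_eq {S : Type*} [Semigroup S] (hS : IsBlockGroup S) {g h : S}
    (hg : g * g = g) (hgh : g * h = h) (hhg : h * g = g) : g = h :=
  hS g g h (by rw [hg, hg]) (by rw [hg, hg]) (by rw [hgh, hhg]) (by rw [hhg, hgh])

/-- An idempotent `e ≤_R s` factors as `e = s * a`. -/
theorem leR.exists_eq_mul {S : Type*} [Semigroup S] {e s : S} (he : e * e = e) (h : leR e s) :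
    ∃ a, e = s * a := by
  rcases h with rfl | h
  · exact ⟨e, he.symm⟩
  · exact h

/-- In a finite block-group, an idempotent `f` fixes `x` on the right as soon as
some product `f * e` does. -/
theorem IsBlockGroup.mul_eq_self {S : Type*} [Semigroup S] [Finite S] (hS : IsBlockGroup S)
    {x e f : S} (hf : f * f = f) (hx : x * (f * e) = x) : x * f = x := by
  obtain ⟨g, ⟨hxg, hfg⟩, hg⟩ := exists_idempotent_mem_of_finite
    {t : S | x * t = x ∧ f * t = t} ⟨f * e, hx, by rw [← mul_assoc, hf]⟩
    (fun a ha b hb => ⟨by rw [← mul_assoc, ha.1, hb.1], by rw [← mul_assoc, ha.2]⟩)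
  have h : g = g * f := hS.eq_of_mul_eq hg
    (by rw [← mul_assoc, hg]) (by rw [mul_assoc, hfg, hg])
  calc x * f = x * (g * f) := by rw [← mul_assoc, hxg]
    _ = x := by rw [← h, hxg]

theorem stmt_11 {S : Type*} [Semigroup S] [Fintype S] (hS : IsBlockGroup S)
    (s x y : S) (hx : inD s x) (hy : inD s y) (hxy : x * s = y * s) :
    x = y := by
  obtain ⟨e, he, hes, hxe⟩ := hx
  obtain ⟨f, hf, hfs, hyf⟩ := hy
  obtain ⟨a, ha⟩ := leR.exists_eq_mul he hes
  obtain ⟨b, hb⟩ := leR.exists_eq_mul hf hfs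
  have hye : y * e = x := by rw [hxe, ha, ← mul_assoc, ← mul_assoc, hxy]
  have hxf : x * f = y := by rw [hyf, hb, ← mul_assoc, ← mul_assoc, hxy]
  have h : x * (f * e) = x := by rw [← mul_assoc, hxf, hye]
  exact (hS.mul_eq_self hf h).symm.trans hxf
end

section
/- Let S be a finite block-group and s ∈ S. The map φ_s : 𝒟(s) → ℐ(s), x ↦ xs, is surjective: for every y ∈ ℐ(s) there exists x ∈ 𝒟(s) with xs = y. -/
theorem stmt_12 {S : Type*} [Semigroup S] [Fintype S] (hS : IsBlockGroup S)
    (s y : S) (hy : inI s y) : ∃ x : S, inD s x ∧ x * s = y := by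
  obtain ⟨e, he, hes, hye⟩ := hy
  obtain ⟨t, ht⟩ : ∃ t, t * s = e := by
    rcases hes with rfl | ⟨t, ht⟩
    · exact ⟨e, he⟩
    · exact ⟨t, ht.symm⟩
  have hee : t * (s * (e * t)) = e * t := by
    rw [← mul_assoc t, ht, ← mul_assoc, he]
  have heet : e * (e * t) = e * t := by rw [← mul_assoc, he]
  refine ⟨y * (e * t), ⟨s * (e * t), ?_, Or.inr ⟨_, rfl⟩, ?_⟩, ?_⟩
  · simp only [mul_assoc, hee, heet]
  · simp only [mul_assoc, hee, heet]
  · rw [mul_assoc, mul_assoc, ht, he, ← hye]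
end

section
/- Let S be a finite block-group and let s ∈ S be a regular element with (unique) inverse s⁻¹. Then 𝒟(s) = Sss⁻¹ = {x·ss⁻¹ : x ∈ S} and ℐ(s) = Ss⁻¹s = {x·s⁻¹s : x ∈ S}. -/
/-- In a block-group, an idempotent `e` with `f e = e` also satisfies `e f = e`. -/
theorem IsBlockGroup.mul_eq_of_mul_eq {S : Type*} [Semigroup S] (hS : IsBlockGroup S)
    {e f : S} (he : e * e = e) (hfe : f * e = e) : e * f = e := by
  have hmul : e * f * e = e := by rw [mul_assoc, hfe, he]
  refine hS e (e * f) e ?_ ?_ ?_ ?_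
  · rw [← mul_assoc, he, hmul]
  · rw [hmul, ← mul_assoc, he]
  · rw [he, he]
  · rw [he, he]

theorem leR.mul_eq {S : Type*} [Semigroup S] {e s f : S} (h : leR e s) (hf : f * s = s) :
    f * e = e := by
  rcases h with rfl | ⟨x, rfl⟩
  · exact hf
  · rw [← mul_assoc, hf]

theorem leL.mul_eq {S : Type*} [Semigroup S] {e s f : S} (h : leL e s) (hf : s * f = s) :
    e * f = e := by
  rcases h with rfl | ⟨x, rfl⟩
  · exact hf
  · rw [mul_assoc, hf]

theorem stmt_15 {S : Type*} [Semigroup S] [Fintype S] (hS : IsBlockGroup S)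
    (s si : S) (h1 : s * si * s = s) (h2 : si * s * si = si) :
    (∀ x : S, inD s x ↔ ∃ y : S, x = y * (s * si)) ∧
    (∀ x : S, inI s x ↔ ∃ y : S, x = y * (si * s)) := by
  have hf : s * si * (s * si) = s * si := by rw [← mul_assoc, h1]
  have hg : si * s * (si * s) = si * s := by rw [← mul_assoc, h2]
  refine ⟨fun x => ⟨?_, ?_⟩, fun x => ⟨?_, ?_⟩⟩
  · rintro ⟨e, he, hle, hx⟩
    refine ⟨x, ?_⟩
    have hef := hS.mul_eq_of_mul_eq he (hle.mul_eq h1)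
    rw [hx, mul_assoc, hef]
  · rintro ⟨y, rfl⟩
    exact ⟨s * si, hf, Or.inr ⟨si, rfl⟩, by rw [mul_assoc, hf]⟩
  · rintro ⟨e, -, hle, hx⟩
    refine ⟨x, ?_⟩
    have heg : e * (si * s) = e := hle.mul_eq (by rw [← mul_assoc, h1])
    rw [hx, mul_assoc, heg]
  · rintro ⟨y, rfl⟩
    exact ⟨si * s, hg, Or.inr ⟨si, rfl⟩, by rw [mul_assoc, hg]⟩
end

section
/- Let S be a finite block-group and let s, t ∈ S be regular elements. If φ_s = φ_t (i.e. 𝒟(s) = 𝒟(t) and xs = xt for all x ∈ 𝒟(s)), then s = t. In other words, the Vagner–Preston representation of a block-group is injective on the set of regular elements. -/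
theorem inD_mul_of_mul_mul_eq {S : Type*} [Semigroup S] {s y : S} (h : s * y * s = s) :
    inD s (s * y) := by
  have he : s * y * (s * y) = s * y := by rw [← mul_assoc, h]
  exact ⟨s * y, he, Or.inr ⟨y, rfl⟩, he.symm⟩

theorem stmt_16 {S : Type*} [Semigroup S] [Fintype S] (hS : IsBlockGroup S)
    (s t : S) (hs : IsRegularElem s) (ht : IsRegularElem t)
    (hD : ∀ x : S, inD s x ↔ inD t x)
    (hphi : ∀ x : S, inD s x → x * s = x * t) :
    s = t := by
  obtain ⟨y, hy⟩ := hs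
  obtain ⟨z, hz⟩ := ht
  have h₁ : s * y * t = s := by rw [← hphi _ (inD_mul_of_mul_mul_eq hy), hy]
  have h₂ : t * z * s = t := by rw [hphi _ ((hD _).2 (inD_mul_of_mul_mul_eq hz)), hz]
  have he : s * y * (s * y) = s * y := by rw [← mul_assoc, hy]
  have hefe : s * y * (t * z) * (s * y) = s * y := by
    rw [← mul_assoc, mul_assoc (s * y), mul_assoc (s * y), h₂, ← mul_assoc, h₁]
  have hfef : t * z * (s * y) * (t * z) = t * z := by
    rw [← mul_assoc, mul_assoc (t * z), mul_assoc (t * z), h₁, ← mul_assoc, h₂]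
  have hef : s * y = t * z :=
    hS (s * y) (s * y) (t * z) (by rw [he, he]) (by rw [he, he]) hefe hfef
  rw [← hy, hef, h₂]
end

section
/- Let S be a finite block-group and let ρ be a congruence on S that separates regular elements (i.e. whenever a, b are regular elements of S with a ρ b, then a = b). If s ρ t, then φ_s = φ_t, i.e. 𝒟(s) = 𝒟(t) and xs = xt for all x ∈ 𝒟(s). Hence ρ is contained in the kernel of the Vagner–Preston representation, so that the kernel of the Vagner–Preston representation is the largest congruence on S separating regular elements. -/
theorem Set.Finite.exists_idempotent_mem {S : Type*} [Semigroup S] {A : Set S} (hA : A.Finite)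
    (hne : A.Nonempty) (hmul : ∀ a ∈ A, ∀ b ∈ A, a * b ∈ A) : ∃ m ∈ A, m * m = m := by
  let _ : TopologicalSpace S := ⊥
  have : DiscreteTopology S := ⟨rfl⟩
  exact exists_idempotent_in_compact_subsemigroup (fun _ => continuous_of_discreteTopology) A hne
    hA.isCompact hmul

theorem leR_iff_exists_mul_of_idempotent {S : Type*} [Semigroup S] {e s : S} (he : e * e = e) :
    leR e s ↔ ∃ y, e = s * y := by
  refine ⟨?_, Or.inr⟩
  rintro (rfl | h)
  exacts [⟨e, he.symm⟩, h]

section SeparatingCongruence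

variable {S : Type*} [Semigroup S] {ρ : S → S → Prop} {e s t : S}

/-- A congruence separating regular elements preserves the idempotents below an element in the
`R`-order. -/
theorem leR_of_rel [Finite S] (hEquiv : Equivalence ρ)
    (hleft : ∀ a b c : S, ρ a b → ρ (c * a) (c * b))
    (hright : ∀ a b c : S, ρ a b → ρ (a * c) (b * c))
    (hsep : ∀ a b : S, IsRegularElem a → IsRegularElem b → ρ a b → a = b)
    (hst : ρ s t) (he : e * e = e) (hes : leR e s) : leR e t := by
  obtain ⟨y, hy⟩ := (leR_iff_exists_mul_of_idempotent he).1 hes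
  obtain ⟨m, ⟨hme, z, hz⟩, hm⟩ :=
    (Set.toFinite {a : S | ρ a e ∧ ∃ z, a = t * z}).exists_idempotent_mem
      ⟨t * y, by rw [hy]; exact hright _ _ _ (hEquiv.symm hst), y, rfl⟩ (by
        rintro a ⟨ha, z, rfl⟩ b ⟨hb, -⟩
        refine ⟨?_, z * b, mul_assoc _ _ _⟩
        have h := hEquiv.trans (hleft _ _ (t * z) hb) (hright _ _ e ha)
        rwa [he] at h)
  have h := hsep m e ⟨m, by rw [hm, hm]⟩ ⟨e, by rw [he, he]⟩ hme
  exact Or.inr ⟨z, h ▸ hz⟩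

theorem isRegularElem_idempotent_mul (he : e * e = e) (hes : leR e s) : IsRegularElem (e * s) := by
  obtain ⟨y, hy⟩ := (leR_iff_exists_mul_of_idempotent he).1 hes
  exact ⟨y, by rw [mul_assoc e s y, ← hy, he, ← mul_assoc, he]⟩

end SeparatingCongruence

theorem stmt_18 {S : Type*} [Semigroup S] [Fintype S] (hS : IsBlockGroup S)
    (ρ : S → S → Prop) (hEquiv : Equivalence ρ)
    (hleft : ∀ a b c : S, ρ a b → ρ (c * a) (c * b))
    (hright : ∀ a b c : S, ρ a b → ρ (a * c) (b * c))
    (hsep : ∀ a b : S, IsRegularElem a → IsRegularElem b → ρ a b → a = b)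
    (s t : S) (hst : ρ s t) :
    (∀ x : S, inD s x ↔ inD t x) ∧ (∀ x : S, inD s x → x * s = x * t) := by
  refine ⟨fun x => ⟨?_, ?_⟩, ?_⟩
  · rintro ⟨e, he, hes, hx⟩
    exact ⟨e, he, leR_of_rel hEquiv hleft hright hsep hst he hes, hx⟩
  · rintro ⟨e, he, het, hx⟩
    exact ⟨e, he, leR_of_rel hEquiv hleft hright hsep (hEquiv.symm hst) he het, hx⟩
  · rintro x ⟨e, he, hes, hx⟩
    have het := leR_of_rel hEquiv hleft hright hsep hst he hes
    have h : e * s = e * t := hsep _ _ (isRegularElem_idempotent_mul he hes)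
      (isRegularElem_idempotent_mul he het) (hleft _ _ _ hst)
    rw [hx, mul_assoc, h, mul_assoc]
end

section
/- A finite semigroup S has exactly one regular element if and only if S is nilpotent, i.e. there exist a zero element z ∈ S (an element with zs = sz = z for all s ∈ S) and an integer n ≥ 1 such that every product of n elements of S equals z (equivalently, a^ω = z for every a ∈ S, where a^ω is the unique idempotent power of a). -/
/-- Product of the nonempty list `a :: l` in a semigroup. -/
def sprod {S : Type*} [Semigroup S] (a : S) : List S → S
  | [] => a
  | b :: l => sprod (a * b) l

theorem exists_idempotent_of_mul_mem {S : Type*} [Semigroup S] [Finite S] (T : Set S)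
    (hne : T.Nonempty) (hmul : ∀ x ∈ T, ∀ y ∈ T, x * y ∈ T) : ∃ e ∈ T, e * e = e := by
  let _ : TopologicalSpace S := ⊥
  have : DiscreteTopology S := ⟨rfl⟩
  exact exists_idempotent_in_compact_subsemigroup (fun _ => continuous_of_discreteTopology)
    T hne T.toFinite.isCompact hmul

theorem IsRegularElem.of_idempotent {S : Type*} [Semigroup S] {e : S} (he : e * e = e) :
    IsRegularElem e :=
  ⟨e, by rw [he, he]⟩

theorem sprod_eq_of_isZero {S : Type*} [Semigroup S] {z : S}
    (h0 : ∀ s : S, z * s = z ∧ s * z = z) (l : List S) :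
    sprod z l = z := by
  induction l with
  | nil => rfl
  | cons b l ih => rw [sprod, (h0 b).1, ih]

section UniqueRegular

variable {S : Type*} [Semigroup S] [Finite S] {z : S}

theorem exists_mul_eq_of_unique_idempotent (hz : ∀ e : S, e * e = e → e = z) (a : S) :
    ∃ x, a * x = z := by
  obtain ⟨_, ⟨x, rfl⟩, he⟩ := exists_idempotent_of_mul_mem (Set.range (a * ·)) ⟨_, a, rfl⟩
    (by rintro _ ⟨x, rfl⟩ _ ⟨y, rfl⟩; exact ⟨x * (a * y), (mul_assoc _ _ _).symm⟩)
  exact ⟨x, hz _ he⟩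

theorem exists_mul_eq_of_unique_idempotent' (hz : ∀ e : S, e * e = e → e = z) (a : S) :
    ∃ x, x * a = z := by
  obtain ⟨_, ⟨x, rfl⟩, he⟩ := exists_idempotent_of_mul_mem (Set.range (· * a)) ⟨_, a, rfl⟩
    (by rintro _ ⟨x, rfl⟩ _ ⟨y, rfl⟩; exact ⟨x * a * y, mul_assoc _ _ _⟩)
  exact ⟨x, hz _ he⟩

theorem isZero_of_unique_regular (hzz : z * z = z) (hz : ∀ a : S, IsRegularElem a → a = z)
    (s : S) : z * s = z ∧ s * z = z := by
  have hi : ∀ e : S, e * e = e → e = z := fun e he => hz e (.of_idempotent he)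
  constructor
  · obtain ⟨x, hx⟩ := exists_mul_eq_of_unique_idempotent hi (z * s)
    exact hz _ ⟨x, by rw [hx, ← mul_assoc, hzz]⟩
  · obtain ⟨x, hx⟩ := exists_mul_eq_of_unique_idempotent' hi (s * z)
    exact hz _ ⟨x, by rw [mul_assoc, hx, mul_assoc, hzz]⟩

theorem eq_of_mul_eq_self (h0 : ∀ s : S, z * s = z ∧ s * z = z)
    (hi : ∀ e : S, e * e = e → e = z) {a q : S} (h : a * q = a) : a = z := by
  obtain ⟨e, he, hee⟩ := exists_idempotent_of_mul_mem {q | a * q = a} ⟨q, h⟩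
    (fun x (hx : a * x = a) y (hy : a * y = a) =>
      show a * (x * y) = a by rw [← mul_assoc, hx, hy])
  have he : a * e = a := he
  rw [← he, hi e hee, (h0 a).2]

theorem sprod_eq_of_ncard_le (h0 : ∀ s : S, z * s = z ∧ s * z = z)
    (hi : ∀ e : S, e * e = e → e = z) (l : List S) :
    ∀ a : S, {x | leR x a}.ncard ≤ l.length + 1 → sprod a l = z := by
  induction l with
  | nil =>
    intro a ha
    exact (Set.ncard_le_one (Set.toFinite _)).1 ha a (Or.inl rfl) z (Or.inr ⟨z, (h0 a).2.symm⟩)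
  | cons b l ih =>
    intro a ha
    by_cases haz : a = z
    · rw [haz, sprod_eq_of_isZero h0]
    · refine ih (a * b) ?_
      have hlt : {x | leR x (a * b)} ⊂ {x | leR x a} := by
        refine Set.ssubset_iff_of_subset ?_ |>.2 ⟨a, Or.inl rfl, ?_⟩
        · rintro x (rfl | ⟨y, rfl⟩)
          · exact Or.inr ⟨b, rfl⟩
          · exact Or.inr ⟨b * y, mul_assoc _ _ _⟩
        · rintro (h | ⟨y, h⟩)
          · exact haz (eq_of_mul_eq_self h0 hi h.symm)
          · exact haz (eq_of_mul_eq_self h0 hi ((mul_assoc a b y).symm.trans h.symm))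
      have := Set.ncard_lt_ncard hlt (Set.toFinite _)
      simp only [List.length_cons] at ha
      omega

end UniqueRegular

theorem sprod_replicate_of_idempotent {S : Type*} [Semigroup S] {e : S} (he : e * e = e) (n : ℕ) :
    sprod e (List.replicate n e) = e := by
  induction n with
  | zero => rfl
  | succ n ih => rw [List.replicate_succ, sprod, he, ih]

theorem stmt_19 {S : Type*} [Semigroup S] [Fintype S] :
    (∃! a : S, IsRegularElem a) ↔
    (∃ z : S, (∀ s : S, z * s = z ∧ s * z = z) ∧
      ∃ n : ℕ, 1 ≤ n ∧ ∀ (a : S) (l : List S), l.length + 1 = n → sprod a l = z) := by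
  constructor
  · rintro ⟨z, ⟨y, hy⟩, hz⟩
    have hi : ∀ e : S, e * e = e → e = z := fun e he => hz e (.of_idempotent he)
    have hzy : z * y = z := hi _ (by rw [← mul_assoc, hy])
    have hzz : z * z = z := by rwa [hzy] at hy
    have h0 := isZero_of_unique_regular hzz hz
    refine ⟨z, h0, Nat.card S, Nat.card_pos_iff.2 ⟨⟨z⟩, inferInstance⟩, fun a l hl => ?_⟩
    refine sprod_eq_of_ncard_le h0 hi l a ?_
    rw [hl, ← Set.ncard_univ]
    exact Set.ncard_le_ncard (Set.subset_univ _)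
  · rintro ⟨z, h0, n, hn, hprod⟩
    refine ⟨z, .of_idempotent (h0 z).1, ?_⟩
    rintro a ⟨y, hy⟩
    have he : a * y * (a * y) = a * y := by rw [← mul_assoc, hy]
    have hez : a * y = z := by
      rw [← sprod_replicate_of_idempotent he (n - 1)]
      exact hprod _ _ (by rw [List.length_replicate]; omega)
    rw [← hy, hez, (h0 a).1]
end
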